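/- Assume the solution is nontrivial (S is not a horizontal line) and u² + v² ≠ 0 at every point of the closure of Ω. If ω ≥ 0 throughout the fluid domain Ω and u < 0 at some crest or at some trough, then the relative speed √(u² + v²) over the closure of Ω is maximized at every trough: for every trough z* and every point z in the closure of Ω, (u² + v²)(z) ≤ (u² + v²)(z*). -/

import Mathlib

open Set

/-- Partial derivative in the horizontal direction. -/
noncomputable def pdX (f : ℝ × ℝ → ℝ) (p : ℝ × ℝ) : ℝ := fderiv ℝ f p (1, 0)

/-- Partial derivative in the vertical direction. -/
noncomputable def pdY (f : ℝ × ℝ → ℝ) (p : ℝ × ℝ) : ℝ := fderiv ℝ f p (0, 1)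

/-- A general (possibly overturning, possibly asymmetric) horizontally `2L`-periodic
steady water wave.  The free surface `S` is the non-self-intersecting `C²` curve
parametrized by `s ↦ (X s, Y s)`, lying above the bed `B = {y = -d}`, and the fluid
domain `Ω` is the open connected `2L`-periodic region whose boundary is `S ∪ B`.
The flow `(u, v)` with pressure `P` solves the steady Euler equations in `Ω`, is
tangent to `S`, has `P = Patm` on `S` and `v = 0` on `B`; `ψ` is a stream function,
vanishing on `S` and equal to the constant `m` on `B`. -/
structure GenPeriodicFlow (g Patm L d : ℝ) : Type where
  X : ℝ → ℝ
  Y : ℝ → ℝ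
  T : ℝ
  u : ℝ × ℝ → ℝ
  v : ℝ × ℝ → ℝ
  P : ℝ × ℝ → ℝ
  ψ : ℝ × ℝ → ℝ
  m : ℝ
  Ω : Set (ℝ × ℝ)
  T_pos : 0 < T
  X_smooth : ContDiff ℝ 2 X
  Y_smooth : ContDiff ℝ 2 Y
  regular : ∀ s, deriv X s ^ 2 + deriv Y s ^ 2 ≠ 0
  X_per : ∀ s, X (s + T) = X s + 2 * L
  Y_per : ∀ s, Y (s + T) = Y s
  S_above_bed : ∀ s, -d < Y s
  S_simple : ∀ s s', X s = X s' → Y s = Y s' → ∃ n : ℤ, s' = s + n * T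
  Ω_open : IsOpen Ω
  Ω_conn : IsConnected Ω
  Ω_per : ∀ p : ℝ × ℝ, p ∈ Ω ↔ (p.1 + 2 * L, p.2) ∈ Ω
  Ω_frontier : frontier Ω = (range fun s => (X s, Y s)) ∪ {p : ℝ × ℝ | p.2 = -d}
  u_smooth : ContDiff ℝ 1 u
  v_smooth : ContDiff ℝ 1 v
  P_smooth : ContDiff ℝ 2 P
  ψ_smooth : ContDiff ℝ 2 ψ
  u_periodic : ∀ x y, u (x + 2 * L, y) = u (x, y)
  v_periodic : ∀ x y, v (x + 2 * L, y) = v (x, y)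
  P_periodic : ∀ x y, P (x + 2 * L, y) = P (x, y)
  euler_x : ∀ p ∈ Ω, u p * pdX u p + v p * pdY u p = -pdX P p
  euler_y : ∀ p ∈ Ω, u p * pdX v p + v p * pdY v p = -(pdY P p) - g
  incompressible : ∀ p ∈ Ω, pdX u p + pdY v p = 0
  surface_pressure : ∀ s, P (X s, Y s) = Patm
  surface_tangency : ∀ s, u (X s, Y s) * deriv Y s = v (X s, Y s) * deriv X s
  bed_kinematic : ∀ x, v (x, -d) = 0
  psi_x : ∀ p ∈ closure Ω, pdX ψ p = -v p
  psi_y : ∀ p ∈ closure Ω, pdY ψ p = u p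
  psi_surface : ∀ s, ψ (X s, Y s) = 0
  psi_bed : ∀ x, ψ (x, -d) = m

namespace GenPeriodicFlow

variable {g Patm L d : ℝ}

/-- The vorticity `ω = v_x - u_y`. -/
noncomputable def vort (F : GenPeriodicFlow g Patm L d) (p : ℝ × ℝ) : ℝ :=
  pdX F.v p - pdY F.u p

/-- The free surface `S`, as a subset of the plane. -/
def surf (F : GenPeriodicFlow g Patm L d) : Set (ℝ × ℝ) :=
  range fun s => (F.X s, F.Y s)

/-- The maximal surface height `maxη = max_S y`. -/
noncomputable def maxη (F : GenPeriodicFlow g Patm L d) : ℝ := sSup (range F.Y)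

/-- The minimal surface height `minη = min_S y`. -/
noncomputable def minη (F : GenPeriodicFlow g Patm L d) : ℝ := sInf (range F.Y)

/-- The solution is nontrivial: `S` is not a horizontal line. -/
def Nontrivial' (F : GenPeriodicFlow g Patm L d) : Prop := ∃ s s', F.Y s ≠ F.Y s'

/-- `n` is an outward (non-fluid side) normal to `S` at the parameter `s`:
it is orthogonal to the tangent vector and points out of the fluid. -/
def IsOutwardNormalAt (F : GenPeriodicFlow g Patm L d) (n : ℝ × ℝ) (s : ℝ) : Prop :=
  n.1 * deriv F.X s + n.2 * deriv F.Y s = 0 ∧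
  ∃ t₀ > 0, ∀ t, 0 < t → t < t₀ → (F.X s + t * n.1, F.Y s + t * n.2) ∉ closure F.Ω

end GenPeriodicFlow

open Filter Topology

/-- A preconnected set that meets an open set and avoids its frontier lies inside it. -/
theorem IsPreconnected.subset_of_disjoint_frontier_of_isOpen {α : Type*} [TopologicalSpace α]
    {s U : Set α} (hs : IsPreconnected s) (hU : IsOpen U) (hsU : (s ∩ U).Nonempty)
    (hd : ∀ x ∈ s, x ∉ frontier U) : s ⊆ U := by
  refine hs.subset_left_of_subset_union hU (isClosed_closure (s := U)).isOpen_compl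
    (disjoint_compl_right.mono_left subset_closure) (fun x hx => ?_) hsU
  by_cases h : x ∈ closure U
  · left
    by_contra h'
    exact hd x hx ⟨h, by rwa [hU.interior_eq]⟩
  · exact Or.inr h

/-- The integral of `γ' / (γ - a)` over `[0, T]`: for a closed curve, `2πi` times the winding
number about `a`. -/
noncomputable def windingIntegral (γ : ℝ → ℂ) (T : ℝ) (a : ℂ) : ℂ :=
  ∫ s in (0 : ℝ)..T, deriv γ s / (γ s - a)

section Winding

variable {γ : ℝ → ℂ} {T : ℝ}

theorem intervalIntegrable_deriv_div_sub (hγ : ContDiff ℝ 1 γ) {a : ℂ} (ha : ∀ s, γ s ≠ a) :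
    IntervalIntegrable (fun s => deriv γ s / (γ s - a)) MeasureTheory.volume 0 T :=
  Continuous.intervalIntegrable ((hγ.continuous_deriv le_rfl).div
    (hγ.continuous.sub continuous_const) fun s => sub_ne_zero.2 (ha s)) _ _

theorem windingIntegral_eq_of_norm_sub_lt (hγ : ContDiff ℝ 1 γ) (hT : γ T = γ 0) {a b : ℂ}
    (hab : ∀ s, ‖a - b‖ < ‖γ s - b‖) : windingIntegral γ T a = windingIntegral γ T b := by
  have hb : ∀ s, γ s ≠ b := fun s h => by
    have := hab s
    rw [h, sub_self, norm_zero] at this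
    exact absurd this (norm_nonneg _).not_gt
  have ha : ∀ s, γ s ≠ a := fun s h => by
    have := hab s
    rw [h] at this
    exact lt_irrefl _ this
  have hd : ∀ s, HasDerivAt (fun s => Complex.log (1 + -((a - b) / (γ s - b))))
      (deriv γ s / (γ s - a) - deriv γ s / (γ s - b)) s := by
    intro s
    have h1 : HasDerivAt γ (deriv γ s) s := (hγ.differentiable one_ne_zero s).hasDerivAt
    have hb' : γ s - b ≠ 0 := sub_ne_zero.2 (hb s)
    have ha' : γ s - a ≠ 0 := sub_ne_zero.2 (ha s)
    have hlt : ‖-((a - b) / (γ s - b))‖ < 1 := by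
      rw [norm_neg, norm_div, div_lt_one (norm_pos_iff.2 hb')]
      exact hab s
    have hmem := Complex.mem_slitPlane_of_norm_lt_one hlt
    have h2 := ((((hasDerivAt_const s (a - b)).fun_div (h1.sub_const b) hb').fun_neg).const_add
      1).clog_real hmem
    convert h2 using 1
    have h3 : 1 + -((a - b) / (γ s - b)) = (γ s - a) / (γ s - b) := by
      field_simp
      ring
    rw [h3]
    field_simp
    ring
  rw [← sub_eq_zero, windingIntegral, windingIntegral, ← intervalIntegral.integral_sub
    (intervalIntegrable_deriv_div_sub hγ ha) (intervalIntegrable_deriv_div_sub hγ hb),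
    intervalIntegral.integral_eq_sub_of_hasDerivAt (fun s _ => hd s)
      ((intervalIntegrable_deriv_div_sub hγ ha).sub (intervalIntegrable_deriv_div_sub hγ hb)), hT,
    sub_self]

theorem windingIntegral_eq_zero (hγ : ContDiff ℝ 1 γ) (hT : γ T = γ 0) {a : ℂ}
    (ha : ∀ s, ‖γ s‖ < ‖a‖) : windingIntegral γ T a = 0 := by
  have ha0 : a ≠ 0 := norm_pos_iff.1 ((norm_nonneg _).trans_lt (ha 0))
  have hne : ∀ s, γ s ≠ a := fun s h => by
    have := ha s
    rw [h] at this
    exact lt_irrefl _ this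
  have hd : ∀ s, HasDerivAt (fun s => Complex.log (1 + -(γ s / a)))
      (deriv γ s / (γ s - a)) s := by
    intro s
    have h1 : HasDerivAt γ (deriv γ s) s := (hγ.differentiable one_ne_zero s).hasDerivAt
    have ha' : γ s - a ≠ 0 := sub_ne_zero.2 (hne s)
    have ha'' : a - γ s ≠ 0 := sub_ne_zero.2 (hne s).symm
    have hlt : ‖-(γ s / a)‖ < 1 := by
      rw [norm_neg, norm_div, div_lt_one (norm_pos_iff.2 ha0)]
      exact ha s
    have hmem := Complex.mem_slitPlane_of_norm_lt_one hlt
    have h2 := (((h1.div_const a).fun_neg).const_add 1).clog_real hmem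
    convert h2 using 1
    have h3 : 1 + -(γ s / a) = (a - γ s) / a := by
      field_simp
      ring
    rw [h3]
    field_simp
    ring
  rw [windingIntegral, intervalIntegral.integral_eq_sub_of_hasDerivAt (fun s _ => hd s)
      (intervalIntegrable_deriv_div_sub hγ hne), hT, sub_self]

end Winding

/-- A curve invariant under a horizontal translation separates the points above it from the points
below it: no connected set avoiding the curve contains both. -/
theorem not_isPreconnected_of_above_below {X Y : ℝ → ℝ} {T L : ℝ} (hT : 0 < T) (hL : 0 < L)
    (hX : ContDiff ℝ 1 X) (hY : ContDiff ℝ 1 Y)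
    (hXT : ∀ s, X (s + T) = X s + 2 * L) (hYT : ∀ s, Y (s + T) = Y s)
    {s : Set (ℝ × ℝ)} (hs : IsPreconnected s)
    (hdisj : ∀ (n : ℤ) (t : ℝ), (X t + n * (2 * L), Y t) ∉ s)
    {p q : ℝ × ℝ} (hp : p ∈ s) (hq : q ∈ s) (hpY : ∀ t, Y t < p.2) (hqY : ∀ t, q.2 < Y t) :
    False := by
  set c : ℝ := Real.pi / L
  have hc0 : 0 < c := div_pos Real.pi_pos hL
  have hcL' : c * L = Real.pi := div_mul_cancel₀ _ hL.ne'
  have hcL : (c : ℂ) * L = Real.pi := by exact_mod_cast hcL'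
  let e : ℝ → ℝ → ℂ := fun x y => Complex.exp (c * (x * Complex.I - y))
  have he : ∀ x y, ‖e x y‖ = Real.exp (-(c * y)) := by
    intro x y
    simp [e, Complex.norm_exp]
  have he_inj : ∀ x y x' y', e x y = e x' y' → y = y' ∧ ∃ n : ℤ, x = x' + n * (2 * L) := by
    intro x y x' y' h
    obtain ⟨n, hn⟩ := Complex.exp_eq_exp_iff_exists_int.1 h
    have hre := congrArg Complex.re hn
    have him := congrArg Complex.im hn
    simp at hre him
    refine ⟨by
      rcases hre with h | h
      · exact h
      · exact absurd h hc0.ne', n, ?_⟩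
    have h2 : c * x = c * (x' + n * (2 * L)) := by rw [him, ← hcL']; ring
    exact mul_left_cancel₀ hc0.ne' h2
  let γ : ℝ → ℂ := fun t => e (X t) (Y t)
  have hγ : ContDiff ℝ 1 γ := by
    refine ContDiff.cexp ?_
    have h1 : ContDiff ℝ 1 fun t => (X t : ℂ) := Complex.ofRealCLM.contDiff.comp hX
    have h2 : ContDiff ℝ 1 fun t => (Y t : ℂ) := Complex.ofRealCLM.contDiff.comp hY
    exact contDiff_const.mul ((h1.mul contDiff_const).sub h2)
  have hγd : ∀ t, HasDerivAt γ (γ t * (c * (deriv X t * Complex.I - deriv Y t))) t := by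
    intro t
    have h1 := (hX.differentiable one_ne_zero t).hasDerivAt.ofReal_comp
    have h2 := (hY.differentiable one_ne_zero t).hasDerivAt.ofReal_comp
    exact (((h1.mul_const Complex.I).sub h2).const_mul (c : ℂ)).cexp
  have hγ0 : ∀ t, γ t ≠ 0 := fun t => Complex.exp_ne_zero _
  have hper : Function.Periodic γ T := by
    intro t
    refine Complex.exp_eq_exp_iff_exists_int.2 ⟨1, ?_⟩
    rw [hXT, hYT]
    push_cast
    linear_combination 2 * Complex.I * hcL
  have hγT : γ T = γ 0 := by simpa using hper 0
  have hlow : windingIntegral γ T (e q.1 q.2) = 0 := by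
    refine windingIntegral_eq_zero hγ hγT fun t => ?_
    rw [he, he, Real.exp_lt_exp]
    nlinarith [hqY t]
  have hup : windingIntegral γ T (e p.1 p.2) = 2 * Real.pi * Complex.I := by
    have h0 : windingIntegral γ T (e p.1 p.2) = windingIntegral γ T 0 := by
      refine windingIntegral_eq_of_norm_sub_lt hγ hγT fun t => ?_
      rw [sub_zero, sub_zero, he, he, Real.exp_lt_exp]
      nlinarith [hpY t]
    rw [h0, windingIntegral, intervalIntegral.integral_eq_sub_of_hasDerivAt
      (f := fun t => c * (X t * Complex.I - Y t)) (fun t _ => ?_)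
      (intervalIntegrable_deriv_div_sub hγ hγ0)]
    · have h1 := hXT 0
      have h2 := hYT 0
      rw [zero_add] at h1 h2
      rw [h1, h2]
      push_cast
      linear_combination 2 * Complex.I * hcL
    · have h1 := (hX.differentiable one_ne_zero t).hasDerivAt.ofReal_comp
      have h2 := (hY.differentiable one_ne_zero t).hasDerivAt.ofReal_comp
      rw [(hγd t).deriv, sub_zero, mul_div_cancel_left₀ _ (hγ0 t)]
      exact ((h1.mul_const Complex.I).sub h2).const_mul (c : ℂ)
  have hE : Continuous fun z : ℝ × ℝ => e z.1 z.2 := by fun_prop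
  have hne : ∀ z ∈ s, ∀ t, γ t ≠ e z.1 z.2 := by
    intro z hz t h
    obtain ⟨h1, n, h2⟩ := he_inj _ _ _ _ h.symm
    apply hdisj n t
    convert hz
    · exact h2.symm
    · exact h1.symm
  have hconst : ∀ z ∈ s, ∀ w ∈ s,
      windingIntegral γ T (e z.1 z.2) = windingIntegral γ T (e w.1 w.2) := by
    intro z hz w hw
    refine hs.induction₂
      (fun z w => windingIntegral γ T (e z.1 z.2) = windingIntegral γ T (e w.1 w.2))
      (fun z hz => ?_) (fun _ _ _ _ _ _ h h' => h.trans h') (fun _ _ _ _ h => h.symm) hz hw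
    obtain ⟨t₀, -, ht₀⟩ := isCompact_Icc.exists_isMinOn (Set.nonempty_Icc.2 hT.le)
      (f := fun t => ‖γ t - e z.1 z.2‖) (by
        exact ((hγ.continuous.sub continuous_const).norm).continuousOn)
    have hpos : 0 < ‖γ t₀ - e z.1 z.2‖ := norm_pos_iff.2 (sub_ne_zero.2 (hne z hz t₀))
    have hev := (hE.tendsto z).eventually (Metric.ball_mem_nhds _ hpos)
    filter_upwards [nhdsWithin_le_nhds hev] with w hw
    refine (windingIntegral_eq_of_norm_sub_lt hγ hγT fun t => ?_).symm
    obtain ⟨t', ht', h⟩ := hper.exists_mem_Ico₀ hT t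
    rw [h]
    rw [dist_eq_norm] at hw
    exact hw.trans_le (ht₀ (Set.Ico_subset_Icc_self ht'))
  have := (hlow.symm.trans (hconst q hq p hp)).trans hup
  exact Complex.two_pi_I_ne_zero this.symm

/-- If `a` vanishes at `p`, then `a * b` is differentiable at `p` as soon as `a` is differentiable
and `b` is continuous there. -/
theorem HasFDerivAt.mul_of_eq_zero {E : Type*} [NormedAddCommGroup E] [NormedSpace ℝ E]
    {a b : E → ℝ} {a' : E →L[ℝ] ℝ} {p : E} (ha : HasFDerivAt a a' p) (h0 : a p = 0)
    (hb : ContinuousAt b p) : HasFDerivAt (fun x => a x * b x) (b p • a') p := by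
  rw [hasFDerivAt_iff_isLittleO] at ha ⊢
  have h1 : (fun x => (a x - a p - a' (x - p)) * b x) =o[𝓝 p] fun x => x - p := by
    have := ha.norm_right.mul_isBigO (hb.isBigO_one ℝ)
    simpa only [mul_one, Asymptotics.isLittleO_norm_right] using this
  have h2 : (fun x => a' (x - p) * (b x - b p)) =o[𝓝 p] fun x => x - p := by
    have h3 : (fun x => b x - b p) =o[𝓝 p] fun _ => (1 : ℝ) := by
      rw [Asymptotics.isLittleO_one_iff]
      simpa using hb.tendsto.sub_const (b p)
    have := ((a'.isBigO_sub (𝓝 p) p).norm_right).mul_isLittleO h3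
    simpa only [mul_one, Asymptotics.isLittleO_norm_right] using this
  refine (h1.add h2).congr_left fun x => ?_
  simp [h0]
  ring

theorem hasDerivAt_pdX {f : ℝ × ℝ → ℝ} (hf : Differentiable ℝ f) (p : ℝ × ℝ) :
    HasDerivAt (fun x => f (x, p.2)) (pdX f p) p.1 := by
  have h := (hasDerivAt_id p.1).prodMk (hasDerivAt_const p.1 p.2)
  exact (hf p).hasFDerivAt.comp_hasDerivAt p.1 h

theorem hasDerivAt_pdY {f : ℝ × ℝ → ℝ} (hf : Differentiable ℝ f) (p : ℝ × ℝ) :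
    HasDerivAt (fun y => f (p.1, y)) (pdY f p) p.2 := by
  have h := (hasDerivAt_const p.2 p.1).prodMk (hasDerivAt_id p.2)
  exact (hf p).hasFDerivAt.comp_hasDerivAt p.2 h

theorem fderiv_eq_pdX_add_pdY (f : ℝ × ℝ → ℝ) (p : ℝ × ℝ) :
    fderiv ℝ f p = pdX f p • ContinuousLinearMap.fst ℝ ℝ ℝ
      + pdY f p • ContinuousLinearMap.snd ℝ ℝ ℝ := by
  ext <;> simp [pdX, pdY]

theorem continuous_pdX {f : ℝ × ℝ → ℝ} (hf : ContDiff ℝ 1 f) : Continuous (pdX f) :=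
  (hf.continuous_fderiv one_ne_zero).clm_apply continuous_const

theorem continuous_pdY {f : ℝ × ℝ → ℝ} (hf : ContDiff ℝ 1 f) : Continuous (pdY f) :=
  (hf.continuous_fderiv one_ne_zero).clm_apply continuous_const

theorem contDiff_pdX {f : ℝ × ℝ → ℝ} (hf : ContDiff ℝ 2 f) : ContDiff ℝ 1 (pdX f) :=
  (hf.fderiv_right (m := 1) (by norm_num)).clm_apply contDiff_const

theorem contDiff_pdY {f : ℝ × ℝ → ℝ} (hf : ContDiff ℝ 2 f) : ContDiff ℝ 1 (pdY f) :=
  (hf.fderiv_right (m := 1) (by norm_num)).clm_apply contDiff_const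

/-- The exterior derivative of `v du - u dv`, for `u` and `v` that are only `C¹`, whenever the
coefficients of this form are differentiable. -/
theorem pdX_add_pdY_eq_two_mul_det {u v h₁ h₂ : ℝ × ℝ → ℝ} {p : ℝ × ℝ}
    (hu : ContDiff ℝ 1 u) (hv : ContDiff ℝ 1 v)
    (h₁d : DifferentiableAt ℝ h₁ p) (h₂d : DifferentiableAt ℝ h₂ p)
    (h₁e : ∀ᶠ q in 𝓝 p, h₁ q = u q * pdY v q - v q * pdY u q)
    (h₂e : ∀ᶠ q in 𝓝 p, h₂ q = v q * pdX u q - u q * pdX v q) :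
    pdX h₁ p + pdY h₂ p = 2 * (pdX u p * pdY v p - pdY u p * pdX v p) := by
  have hud := (hu.differentiable one_ne_zero)
  have hvd := (hv.differentiable one_ne_zero)
  have hφ : ∀ q, HasFDerivAt (fun q => u p * v q - v p * u q)
      ((u p * pdX v q - v p * pdX u q) • ContinuousLinearMap.fst ℝ ℝ ℝ
        + (u p * pdY v q - v p * pdY u q) • ContinuousLinearMap.snd ℝ ℝ ℝ) q := fun q =>
    (((hvd q).hasFDerivAt.const_mul (u p)).sub
      ((hud q).hasFDerivAt.const_mul (v p))).congr_fderiv (by ext <;> simp [pdX, pdY])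
  have hu0 : HasFDerivAt (fun q => u q - u p) (fderiv ℝ u p) p := (hud p).hasFDerivAt.sub_const _
  have hv0 : HasFDerivAt (fun q => v q - v p) (fderiv ℝ v p) p := (hvd p).hasFDerivAt.sub_const _
  have hY : HasFDerivAt (fun q => u p * pdY v q - v p * pdY u q)
      (fderiv ℝ h₁ p - (pdY v p • fderiv ℝ u p - pdY u p • fderiv ℝ v p)) p := by
    refine HasFDerivAt.congr_of_eventuallyEq (h₁d.hasFDerivAt.sub
      ((hu0.mul_of_eq_zero (sub_self _) (continuous_pdY hv).continuousAt).sub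
        (hv0.mul_of_eq_zero (sub_self _) (continuous_pdY hu).continuousAt))) ?_
    filter_upwards [h₁e] with q hq
    simp only [Pi.sub_apply, hq]
    ring
  have hX : HasFDerivAt (fun q => u p * pdX v q - v p * pdX u q)
      (-fderiv ℝ h₂ p - (pdX v p • fderiv ℝ u p - pdX u p • fderiv ℝ v p)) p := by
    refine HasFDerivAt.congr_of_eventuallyEq (h₂d.hasFDerivAt.neg.sub
      ((hu0.mul_of_eq_zero (sub_self _) (continuous_pdX hv).continuousAt).sub
        (hv0.mul_of_eq_zero (sub_self _) (continuous_pdX hu).continuousAt))) ?_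
    filter_upwards [h₂e] with q hq
    simp only [Pi.sub_apply, Pi.neg_apply, hq]
    ring
  have hD := (hX.smul_const (ContinuousLinearMap.fst ℝ ℝ ℝ)).add
    (hY.smul_const (ContinuousLinearMap.snd ℝ ℝ ℝ))
  have hsymm := second_derivative_symmetric_of_eventually (Eventually.of_forall hφ) hD
    (1, 0) (0, 1)
  simp at hsymm
  simp only [pdX, pdY] at hsymm ⊢
  linarith

theorem IsLocalMax.deriv_deriv_nonpos {f : ℝ → ℝ} {x : ℝ} (h : IsLocalMax f x)
    (hc : ContinuousAt f x) : deriv (deriv f) x ≤ 0 := by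
  by_contra! hpos
  have hmin := isLocalMin_of_deriv_deriv_pos hpos h.deriv_eq_zero hc
  have heq : f =ᶠ[𝓝 x] fun _ => f x := by
    filter_upwards [h, hmin] with y h1 h2 using le_antisymm h1 h2
  rw [heq.deriv.deriv_eq] at hpos
  simp at hpos

theorem IsLocalMax.pdX_eq_zero {f : ℝ × ℝ → ℝ} {p : ℝ × ℝ} (h : IsLocalMax f p) :
    pdX f p = 0 := by
  simp [pdX, h.fderiv_eq_zero]

theorem IsLocalMax.pdY_eq_zero {f : ℝ × ℝ → ℝ} {p : ℝ × ℝ} (h : IsLocalMax f p) :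
    pdY f p = 0 := by
  simp [pdY, h.fderiv_eq_zero]

theorem IsLocalMax.pdX_pdX_nonpos {f : ℝ × ℝ → ℝ} {p : ℝ × ℝ} (h : IsLocalMax f p)
    (hf : ContDiff ℝ 2 f) : pdX (pdX f) p ≤ 0 := by
  have hline : Continuous fun x : ℝ => (x, p.2) := by fun_prop
  have hd : deriv (fun x => f (x, p.2)) = fun x => pdX f (x, p.2) := by
    ext x
    exact (hasDerivAt_pdX (hf.differentiable two_ne_zero) (x, p.2)).deriv
  have h2 := IsLocalMax.deriv_deriv_nonpos (f := fun x => f (x, p.2)) (x := p.1)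
    ((hline.tendsto p.1).eventually h) (hf.continuous.comp hline).continuousAt
  rwa [hd, (hasDerivAt_pdX ((contDiff_pdX hf).differentiable one_ne_zero) p).deriv] at h2

theorem IsLocalMax.pdY_pdY_nonpos {f : ℝ × ℝ → ℝ} {p : ℝ × ℝ} (h : IsLocalMax f p)
    (hf : ContDiff ℝ 2 f) : pdY (pdY f) p ≤ 0 := by
  have hline : Continuous fun y : ℝ => (p.1, y) := by fun_prop
  have hd : deriv (fun y => f (p.1, y)) = fun y => pdY f (p.1, y) := by
    ext y
    exact (hasDerivAt_pdY (hf.differentiable two_ne_zero) (p.1, y)).deriv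
  have h2 := IsLocalMax.deriv_deriv_nonpos (f := fun y => f (p.1, y)) (x := p.2)
    ((hline.tendsto p.2).eventually h) (hf.continuous.comp hline).continuousAt
  rwa [hd, (hasDerivAt_pdY ((contDiff_pdY hf).differentiable one_ne_zero) p).deriv] at h2

theorem HasDerivAt.eventually_lt_right {f : ℝ → ℝ} {f' x : ℝ} (hf : HasDerivAt f f' x)
    (hpos : 0 < f') : ∀ᶠ y in 𝓝[>] x, f x < f y := by
  have h := (hasDerivAt_iff_tendsto_slope.1 hf).eventually (lt_mem_nhds hpos)
  have h' := nhdsWithin_mono x (fun y (hy : x < y) => hy.ne') h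
  filter_upwards [h', self_mem_nhdsWithin] with y hy hxy
  rw [slope_def_field] at hy
  exact sub_pos.1 ((div_pos_iff_of_pos_right (sub_pos.2 hxy)).1 hy)

theorem HasDerivAt.eventually_lt_left {f : ℝ → ℝ} {f' x : ℝ} (hf : HasDerivAt f f' x)
    (hneg : f' < 0) : ∀ᶠ y in 𝓝[<] x, f x < f y := by
  have h := (hasDerivAt_iff_tendsto_slope.1 hf).eventually (gt_mem_nhds hneg)
  have h' := nhdsWithin_mono x (fun y (hy : y < x) => hy.ne) h
  filter_upwards [h', self_mem_nhdsWithin] with y hy hxy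
  rw [slope_def_field] at hy
  have h1 := sub_neg.2 (mem_Iio.1 hxy)
  rcases div_neg_iff.1 hy with h2 | h2
  · exact sub_pos.1 h2.1
  · exact absurd h2.2 h1.not_gt

theorem pdX_eq_of_hasDerivAt {f : ℝ × ℝ → ℝ} (hf : Differentiable ℝ f) {p : ℝ × ℝ} {f' : ℝ}
    (h : HasDerivAt (fun x => f (x, p.2)) f' p.1) : pdX f p = f' :=
  (hasDerivAt_pdX hf p).unique h

theorem pdY_eq_of_hasDerivAt {f : ℝ × ℝ → ℝ} (hf : Differentiable ℝ f) {p : ℝ × ℝ} {f' : ℝ}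
    (h : HasDerivAt (fun y => f (p.1, y)) f' p.2) : pdY f p = f' :=
  (hasDerivAt_pdY hf p).unique h

theorem le_of_forall_pos_add_mul_le {a b C D : ℝ}
    (h : ∀ ε > 0, a + ε * b ≤ C + ε * D) : a ≤ C := by
  have h1 : Tendsto (fun ε : ℝ => a + ε * b) (𝓝[>] 0) (𝓝 a) := by
    have : Continuous fun ε : ℝ => a + ε * b := by fun_prop
    simpa using (this.tendsto 0).mono_left nhdsWithin_le_nhds
  have h2 : Tendsto (fun ε : ℝ => C + ε * D) (𝓝[>] 0) (𝓝 C) := by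
    have : Continuous fun ε : ℝ => C + ε * D := by fun_prop
    simpa using (this.tendsto 0).mono_left nhdsWithin_le_nhds
  refine le_of_tendsto_of_tendsto h1 h2 ?_
  filter_upwards [self_mem_nhdsWithin] with ε hε using h ε hε

namespace GenPeriodicFlow

variable {g Patm L d : ℝ} (F : GenPeriodicFlow g Patm L d)

theorem surf_mem_frontier (s : ℝ) : (F.X s, F.Y s) ∈ frontier F.Ω := by
  rw [F.Ω_frontier]
  exact Or.inl ⟨s, rfl⟩

theorem bed_mem_frontier (x : ℝ) : (x, -d) ∈ frontier F.Ω := by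
  rw [F.Ω_frontier]
  exact Or.inr rfl

theorem surf_mem_closure (s : ℝ) : (F.X s, F.Y s) ∈ closure F.Ω :=
  frontier_subset_closure (F.surf_mem_frontier s)

theorem bed_mem_closure (x : ℝ) : (x, -d) ∈ closure F.Ω :=
  frontier_subset_closure (F.bed_mem_frontier x)

theorem notMem_frontier {p : ℝ × ℝ} (hp : p ∈ F.Ω) : p ∉ frontier F.Ω := fun h =>
  (F.Ω_open.inter_frontier_eq.subset ⟨hp, h⟩).elim

theorem exists_forall_Y_le : ∃ s, ∀ t, F.Y t ≤ F.Y s := by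
  obtain ⟨s, -, hs⟩ := isCompact_Icc.exists_isMaxOn (Set.nonempty_Icc.2 F.T_pos.le)
    F.Y_smooth.continuous.continuousOn
  refine ⟨s, fun t => ?_⟩
  obtain ⟨t', ht', h⟩ := Function.Periodic.exists_mem_Ico₀ F.Y_per F.T_pos t
  rw [h]
  exact hs (Ico_subset_Icc_self ht')

theorem exists_forall_le_Y : ∃ s, ∀ t, F.Y s ≤ F.Y t := by
  obtain ⟨s, -, hs⟩ := isCompact_Icc.exists_isMinOn (Set.nonempty_Icc.2 F.T_pos.le)
    F.Y_smooth.continuous.continuousOn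
  refine ⟨s, fun t => ?_⟩
  obtain ⟨t', ht', h⟩ := Function.Periodic.exists_mem_Ico₀ F.Y_per F.T_pos t
  rw [h]
  exact hs (Ico_subset_Icc_self ht')

theorem Y_le_maxη (t : ℝ) : F.Y t ≤ F.maxη := by
  obtain ⟨s, hs⟩ := F.exists_forall_Y_le
  exact le_csSup ⟨F.Y s, by rintro _ ⟨t, rfl⟩; exact hs t⟩ ⟨t, rfl⟩

theorem minη_le_Y (t : ℝ) : F.minη ≤ F.Y t := by
  obtain ⟨s, hs⟩ := F.exists_forall_le_Y
  exact csInf_le ⟨F.Y s, by rintro _ ⟨t, rfl⟩; exact hs t⟩ ⟨t, rfl⟩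

theorem neg_d_lt_of_mem {p : ℝ × ℝ} (hp : p ∈ F.Ω) : -d < p.2 := by
  have hpre : IsPreconnected (Prod.snd '' F.Ω) :=
    F.Ω_conn.isPreconnected.image _ continuous_snd.continuousOn
  have hopen : IsOpen {q : ℝ × ℝ | -d < q.2} := isOpen_lt continuous_const continuous_snd
  obtain ⟨q, hq, hqΩ⟩ := mem_closure_iff.1 (F.surf_mem_closure 0) _ hopen (F.S_above_bed 0)
  by_contra! h
  obtain ⟨r, hr, hrd⟩ := hpre.ordConnected.out ⟨p, hp, rfl⟩ ⟨q, hqΩ, rfl⟩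
    ⟨h, le_of_lt hq⟩
  refine F.notMem_frontier hr ?_
  rw [F.Ω_frontier]
  exact Or.inr hrd

theorem neg_d_le_of_mem_closure {p : ℝ × ℝ} (hp : p ∈ closure F.Ω) : -d ≤ p.2 :=
  closure_minimal (fun _ hq => (F.neg_d_lt_of_mem hq).le)
    (isClosed_le continuous_const continuous_snd) hp

theorem mem_of_lt_Y {p : ℝ × ℝ} (hpd : -d < p.2) (hpY : ∀ t, p.2 < F.Y t) : p ∈ F.Ω := by
  obtain ⟨s, hs⟩ := F.exists_forall_le_Y
  have hconv : Convex ℝ {q : ℝ × ℝ | -d < q.2 ∧ q.2 < F.Y s} := by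
    have h : {q : ℝ × ℝ | -d < q.2 ∧ q.2 < F.Y s} = LinearMap.snd ℝ ℝ ℝ ⁻¹' Ioo (-d) (F.Y s) :=
      rfl
    rw [h]
    exact (convex_Ioo _ _).linear_preimage _
  have hopen : IsOpen {q : ℝ × ℝ | q.2 < F.Y s} := isOpen_lt continuous_snd continuous_const
  obtain ⟨q, hq, hqΩ⟩ := mem_closure_iff.1 (F.bed_mem_closure 0) _ hopen (F.S_above_bed s)
  refine hconv.isPreconnected.subset_of_disjoint_frontier_of_isOpen F.Ω_open
    ⟨q, ⟨F.neg_d_lt_of_mem hqΩ, hq⟩, hqΩ⟩ (fun r hr hrf => ?_) ⟨hpd, hpY s⟩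
  rw [F.Ω_frontier] at hrf
  rcases hrf with ⟨t, rfl⟩ | hrf
  · exact (hs t).not_gt hr.2
  · exact hr.1.ne' hrf

theorem X_add_int_mul (s : ℝ) (n : ℤ) : F.X (s + n * F.T) = F.X s + n * (2 * L) := by
  have hT := F.T_pos.ne'
  have h : Function.Periodic (fun s => F.X s - 2 * L / F.T * s) F.T := by
    intro s
    simp only [F.X_per]
    field_simp
    ring
  have h1 : F.X (s + n * F.T) - 2 * L / F.T * (s + n * F.T) = F.X s - 2 * L / F.T * s :=
    h.int_mul n s
  have h2 : 2 * L / F.T * (s + n * F.T) = 2 * L / F.T * s + n * (2 * L) := by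
    field_simp
  linarith

theorem le_of_mem (hL : 0 < L) {M : ℝ} (hM : ∀ t, F.Y t ≤ M) {p : ℝ × ℝ} (hp : p ∈ F.Ω) :
    p.2 ≤ M := by
  by_contra! h
  obtain ⟨s, hs⟩ := F.exists_forall_le_Y
  obtain ⟨y, hy1, hy2⟩ := exists_between (F.S_above_bed s)
  refine not_isPreconnected_of_above_below F.T_pos hL (F.X_smooth.of_le one_le_two)
    (F.Y_smooth.of_le one_le_two) F.X_per F.Y_per F.Ω_conn.isPreconnected (fun n t ht => ?_) hp
    (F.mem_of_lt_Y (p := (0, y)) hy1 fun t => hy2.trans_le (hs t))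
    (fun t => (hM t).trans_lt h) (fun t => hy2.trans_le (hs t))
  rw [← F.X_add_int_mul, ← Function.Periodic.int_mul F.Y_per n t] at ht
  exact F.notMem_frontier ht (F.surf_mem_frontier _)

theorem le_of_mem_closure (hL : 0 < L) {M : ℝ} (hM : ∀ t, F.Y t ≤ M) {p : ℝ × ℝ}
    (hp : p ∈ closure F.Ω) : p.2 ≤ M :=
  closure_minimal (fun _ hq => F.le_of_mem hL hM hq) (isClosed_le continuous_snd continuous_const)
    hp

theorem mem_closure_add_iff (p : ℝ × ℝ) :
    (p.1 + 2 * L, p.2) ∈ closure F.Ω ↔ p ∈ closure F.Ω := by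
  have h : (Homeomorph.addRight ((2 * L, 0) : ℝ × ℝ)) ⁻¹' F.Ω = F.Ω := by
    ext q
    rw [F.Ω_per q]
    simp [Prod.add_def]
  have h2 := (Homeomorph.addRight ((2 * L, 0) : ℝ × ℝ)).preimage_closure F.Ω
  rw [h] at h2
  simpa [Prod.add_def] using Set.ext_iff.1 h2 p

/-- The closed fluid domain over one period. -/
def cell : Set (ℝ × ℝ) := closure F.Ω ∩ {p | p.1 ∈ Icc 0 (2 * L)}

theorem isCompact_cell (hL : 0 < L) : IsCompact F.cell := by
  obtain ⟨s, hs⟩ := F.exists_forall_Y_le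
  have hbox : IsCompact (Icc 0 (2 * L) ×ˢ Icc (-d) (F.Y s)) := isCompact_Icc.prod isCompact_Icc
  refine hbox.of_isClosed_subset (isClosed_closure.inter (isClosed_Icc.preimage continuous_fst)) ?_
  rintro p ⟨hp, hp1⟩
  exact ⟨hp1, F.neg_d_le_of_mem_closure hp, F.le_of_mem_closure hL hs hp⟩

theorem exists_mem_cell (hL : 0 < L) {f : ℝ × ℝ → ℝ}
    (hper : ∀ p ∈ closure F.Ω, f (p.1 + 2 * L, p.2) = f p) {p : ℝ × ℝ} (hp : p ∈ closure F.Ω) :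
    ∃ q ∈ F.cell, f q = f p := by
  have h : Function.Periodic (fun x => (x, p.2) ∈ closure F.Ω ∧ f (x, p.2) = f p) (2 * L) := by
    intro x
    have h1 := F.mem_closure_add_iff (x, p.2)
    have h2 := hper (x, p.2)
    simp only [eq_iff_iff] at h1 h2 ⊢
    constructor
    · rintro ⟨h3, h4⟩
      exact ⟨h1.1 h3, by rw [← h2 (h1.1 h3), h4]⟩
    · rintro ⟨h3, h4⟩
      exact ⟨h1.2 h3, by rw [h2 h3, h4]⟩
  obtain ⟨x, hx, hxp⟩ := h.exists_mem_Ico₀ (by positivity) p.1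
  have h3 := hxp.mp ⟨hp, rfl⟩
  exact ⟨(x, p.2), ⟨h3.1, Ico_subset_Icc_self hx⟩, h3.2⟩

/-- A periodic function on the closed fluid domain that has no local maximum in the interior and
is strictly increasing away from the bed is bounded by its supremum over the free surface. -/
theorem le_of_surface_le (hL : 0 < L) {f : ℝ × ℝ → ℝ} {C : ℝ} (hf : Differentiable ℝ f)
    (hper : ∀ p ∈ closure F.Ω, f (p.1 + 2 * L, p.2) = f p) (hS : ∀ s, f (F.X s, F.Y s) ≤ C)
    (hint : ∀ p ∈ F.Ω, p ∈ F.cell → ¬ IsLocalMax f p) (hbed : ∀ x, 0 < pdY f (x, -d)) :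
    ∀ p ∈ closure F.Ω, f p ≤ C := by
  obtain ⟨q, hq, hmax⟩ := (F.isCompact_cell hL).exists_isMaxOn
    (let ⟨q, hq, _⟩ := F.exists_mem_cell hL hper (F.bed_mem_closure 0); ⟨q, hq⟩)
    hf.continuous.continuousOn
  have hle : ∀ p ∈ closure F.Ω, f p ≤ f q := by
    intro p hp
    obtain ⟨r, hr, hrp⟩ := F.exists_mem_cell hL hper hp
    exact hrp ▸ hmax hr
  suffices h : f q ≤ C from fun p hp => (hle p hp).trans h
  by_cases hqΩ : q ∈ F.Ω
  · refine absurd ?_ (hint q hqΩ hq)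
    filter_upwards [F.Ω_open.mem_nhds hqΩ] with p hp using hle p (subset_closure hp)
  have hqf : q ∈ frontier F.Ω := ⟨hq.1, by rwa [F.Ω_open.interior_eq]⟩
  rw [F.Ω_frontier] at hqf
  rcases hqf with ⟨s, rfl⟩ | hqd
  · exact hS s
  obtain ⟨x, y⟩ := q
  obtain rfl : y = -d := hqd
  obtain ⟨s, hs⟩ := F.exists_forall_le_Y
  have hev := (hasDerivAt_pdY hf (x, -d)).eventually_lt_right (hbed x)
  obtain ⟨y, hy, hy'⟩ := (hev.and (Ioo_mem_nhdsGT (F.S_above_bed s))).exists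
  exact absurd (hle (x, y) (subset_closure
    (F.mem_of_lt_Y hy'.1 fun t => hy'.2.trans_le (hs t)))) hy.not_ge

theorem eqOn_closure {f₁ f₂ : ℝ × ℝ → ℝ} (h₁ : Continuous f₁) (h₂ : Continuous f₂)
    (h : ∀ p ∈ F.Ω, f₁ p = f₂ p) : ∀ p ∈ closure F.Ω, f₁ p = f₂ p :=
  closure_minimal h (isClosed_eq h₁ h₂)

theorem ψ_periodic : ∀ p ∈ closure F.Ω, F.ψ (p.1 + 2 * L, p.2) = F.ψ p := by
  have hd : Differentiable ℝ F.ψ := F.ψ_smooth.differentiable two_ne_zero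
  set τ : ℝ × ℝ := (2 * L, 0)
  have hτ : ∀ p : ℝ × ℝ, p + τ = (p.1 + 2 * L, p.2) := fun p => by simp [τ, Prod.add_def]
  have hdτ : Differentiable ℝ fun p => F.ψ (p + τ) := hd.comp (differentiable_id.add_const τ)
  have hfd : F.Ω.EqOn (fderiv ℝ fun p => F.ψ (p + τ) - F.ψ p) 0 := by
    intro p hp
    have hp' : p + τ ∈ closure F.Ω := by
      rw [hτ]
      exact subset_closure ((F.Ω_per p).1 hp)
    have hpc := subset_closure hp
    rw [fderiv_fun_sub (hdτ p) (hd p), fderiv_comp_add_right, fderiv_eq_pdX_add_pdY,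
      fderiv_eq_pdX_add_pdY F.ψ p, F.psi_x _ hp', F.psi_y _ hp', F.psi_x _ hpc, F.psi_y _ hpc, hτ,
      F.u_periodic p.1 p.2, F.v_periodic p.1 p.2, sub_self, Pi.zero_apply]
  obtain ⟨c, hc⟩ := F.Ω_open.exists_is_const_of_fderiv_eq_zero F.Ω_conn.isPreconnected
    (hdτ.sub hd).differentiableOn hfd
  have hcl := F.eqOn_closure (hdτ.sub hd).continuous continuous_const hc
  have hc0 : c = 0 := by
    rw [← hcl _ (F.surf_mem_closure 0)]
    simp only [Pi.sub_apply, hτ]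
    rw [← F.X_per, ← F.Y_per 0, F.psi_surface, F.Y_per, F.psi_surface, sub_self]
  intro p hp
  have := hcl p hp
  simp only [Pi.sub_apply, hτ, hc0] at this
  exact sub_eq_zero.1 this

theorem differentiable_u : Differentiable ℝ F.u := F.u_smooth.differentiable one_ne_zero

theorem differentiable_v : Differentiable ℝ F.v := F.v_smooth.differentiable one_ne_zero

theorem differentiable_P : Differentiable ℝ F.P := F.P_smooth.differentiable two_ne_zero

theorem differentiable_ψ : Differentiable ℝ F.ψ := F.ψ_smooth.differentiable two_ne_zero

theorem continuous_vort : Continuous F.vort :=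
  (continuous_pdX F.v_smooth).sub (continuous_pdY F.u_smooth)

theorem vort_nonneg_of_mem_closure (hω : ∀ p ∈ F.Ω, 0 ≤ F.vort p) :
    ∀ p ∈ closure F.Ω, 0 ≤ F.vort p :=
  closure_minimal hω (isClosed_le continuous_const F.continuous_vort)

/-- The total head `(u² + v²) / 2 + P + g y`. -/
noncomputable def head (p : ℝ × ℝ) : ℝ := (F.u p ^ 2 + F.v p ^ 2) / 2 + F.P p + g * p.2

theorem differentiable_head : Differentiable ℝ F.head := by
  have hu := F.differentiable_u
  have hv := F.differentiable_v
  have hP := F.differentiable_P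
  unfold head
  fun_prop

theorem pdX_head (p : ℝ × ℝ) :
    pdX F.head p = F.u p * pdX F.u p + F.v p * pdX F.v p + pdX F.P p := by
  refine pdX_eq_of_hasDerivAt F.differentiable_head ?_
  refine HasDerivAt.congr_deriv (((HasDerivAt.div_const
    (((hasDerivAt_pdX F.differentiable_u p).pow 2).add
      ((hasDerivAt_pdX F.differentiable_v p).pow 2)) 2).add
    (hasDerivAt_pdX F.differentiable_P p)).add_const (g * p.2)) ?_
  push_cast
  ring

theorem pdY_head (p : ℝ × ℝ) :
    pdY F.head p = F.u p * pdY F.u p + F.v p * pdY F.v p + pdY F.P p + g := by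
  refine pdY_eq_of_hasDerivAt F.differentiable_head ?_
  refine HasDerivAt.congr_deriv (((HasDerivAt.div_const
    (((hasDerivAt_pdY F.differentiable_u p).pow 2).add
      ((hasDerivAt_pdY F.differentiable_v p).pow 2)) 2).add
    (hasDerivAt_pdY F.differentiable_P p)).add ((hasDerivAt_id p.2).const_mul g)) ?_
  push_cast
  ring

theorem pdX_head_eq : ∀ p ∈ closure F.Ω, pdX F.head p = F.vort p * F.v p := by
  have hu := F.u_smooth.continuous
  have hv := F.v_smooth.continuous
  have hux := continuous_pdX F.u_smooth
  have hvx := continuous_pdX F.v_smooth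
  have hPx := continuous_pdX (F.P_smooth.of_le one_le_two)
  have hω := F.continuous_vort
  refine F.eqOn_closure ?_ (by fun_prop) fun p hp => ?_
  · simp_rw [funext F.pdX_head]
    fun_prop
  · rw [pdX_head, vort]
    linarith [F.euler_x p hp]

theorem pdY_head_eq : ∀ p ∈ closure F.Ω, pdY F.head p = -(F.vort p * F.u p) := by
  have hu := F.u_smooth.continuous
  have hv := F.v_smooth.continuous
  have huy := continuous_pdY F.u_smooth
  have hvy := continuous_pdY F.v_smooth
  have hPy := continuous_pdY (F.P_smooth.of_le one_le_two)
  have hω := F.continuous_vort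
  refine F.eqOn_closure ?_ (by fun_prop) fun p hp => ?_
  · simp_rw [funext F.pdY_head]
    fun_prop
  · rw [pdY_head, vort]
    linarith [F.euler_y p hp]

theorem head_surface_eq (s t : ℝ) : F.head (F.X s, F.Y s) = F.head (F.X t, F.Y t) := by
  have hd : ∀ s, HasDerivAt (fun s => F.head (F.X s, F.Y s)) 0 s := by
    intro s
    have hX := (F.X_smooth.differentiable two_ne_zero s).hasDerivAt
    have hY := (F.Y_smooth.differentiable two_ne_zero s).hasDerivAt
    have h := (F.differentiable_head (F.X s, F.Y s)).hasFDerivAt.comp_hasDerivAt s (hX.prodMk hY)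
    refine HasDerivAt.congr_deriv h ?_
    rw [fderiv_eq_pdX_add_pdY, F.pdX_head_eq _ (F.surf_mem_closure s),
      F.pdY_head_eq _ (F.surf_mem_closure s)]
    simp
    linear_combination -F.vort (F.X s, F.Y s) * F.surface_tangency s
  exact is_const_of_deriv_eq_zero (fun s => (hd s).differentiableAt) (fun s => (hd s).deriv) s t

theorem head_periodic (p : ℝ × ℝ) : F.head (p.1 + 2 * L, p.2) = F.head p := by
  simp only [head, F.u_periodic, F.v_periodic, F.P_periodic]

theorem head_le_surface (hL : 0 < L)
    (hstag : ∀ p ∈ closure F.Ω, F.u p ^ 2 + F.v p ^ 2 ≠ 0)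
    (hω : ∀ p ∈ F.Ω, 0 ≤ F.vort p) (hbed : ∀ x, F.u (x, -d) < 0) (s : ℝ) :
    ∀ p ∈ closure F.Ω, F.head p ≤ F.head (F.X s, F.Y s) := by
  intro p hp
  refine le_of_forall_pos_add_mul_le (b := -F.ψ p) (D := 0) fun ε hε => ?_
  have hdiff : Differentiable ℝ fun p => F.head p + ε * -F.ψ p :=
    F.differentiable_head.add (F.differentiable_ψ.neg.const_mul ε)
  have hX : ∀ p ∈ closure F.Ω, pdX (fun p => F.head p + ε * -F.ψ p) p = (F.vort p + ε) * F.v p := by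
    intro p hp
    refine pdX_eq_of_hasDerivAt hdiff ?_
    refine HasDerivAt.congr_deriv ((hasDerivAt_pdX F.differentiable_head p).add
      ((hasDerivAt_pdX F.differentiable_ψ p).neg.const_mul ε)) ?_
    rw [F.pdX_head_eq p hp, F.psi_x p hp]
    ring
  have hY : ∀ p ∈ closure F.Ω,
      pdY (fun p => F.head p + ε * -F.ψ p) p = -((F.vort p + ε) * F.u p) := by
    intro p hp
    refine pdY_eq_of_hasDerivAt hdiff ?_
    refine HasDerivAt.congr_deriv ((hasDerivAt_pdY F.differentiable_head p).add
      ((hasDerivAt_pdY F.differentiable_ψ p).neg.const_mul ε)) ?_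
    rw [F.pdY_head_eq p hp, F.psi_y p hp]
    ring
  have hpos : ∀ p ∈ closure F.Ω, 0 < F.vort p + ε := fun p hp =>
    add_pos_of_nonneg_of_pos (F.vort_nonneg_of_mem_closure hω p hp) hε
  refine F.le_of_surface_le hL hdiff (fun p hp => ?_) (fun t => ?_) (fun p hp _ hmax => ?_)
    (fun x => ?_) p hp
  · simp only [F.head_periodic, F.ψ_periodic p hp]
  · simp [F.psi_surface, F.head_surface_eq t s]
  · have hp' := subset_closure hp
    have h1 := hmax.pdX_eq_zero
    have h2 := hmax.pdY_eq_zero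
    rw [hX p hp'] at h1
    rw [hY p hp', neg_eq_zero] at h2
    have hv := (mul_eq_zero.1 h1).resolve_left (hpos p hp').ne'
    have hu := (mul_eq_zero.1 h2).resolve_left (hpos p hp').ne'
    exact hstag p hp' (by rw [hu, hv]; norm_num)
  · have hx := F.bed_mem_closure x
    rw [hY _ hx, neg_pos]
    exact mul_neg_of_pos_of_neg (hpos _ hx) (hbed x)

theorem exists_neg_two_mul_vort_mul_u_le (hL : 0 < L)
    (hstag : ∀ p ∈ closure F.Ω, F.u p ^ 2 + F.v p ^ 2 ≠ 0) :
    ∃ k > 0, ∀ p ∈ F.cell, -2 * F.vort p * F.u p ≤ k * (F.u p ^ 2 + F.v p ^ 2) := by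
  have hu := F.u_smooth.continuous
  have hv := F.v_smooth.continuous
  have hω := F.continuous_vort
  have hc : ContinuousOn (fun p => -2 * F.vort p * F.u p / (F.u p ^ 2 + F.v p ^ 2)) F.cell :=
    ContinuousOn.div (by fun_prop) (by fun_prop) fun p hp => hstag p hp.1
  obtain ⟨C, hC⟩ := (F.isCompact_cell hL).bddAbove_image hc
  refine ⟨max C 1, by positivity, fun p hp => ?_⟩
  have hq : 0 < F.u p ^ 2 + F.v p ^ 2 := (hstag p hp.1).symm.lt_of_le (by positivity)
  rw [← div_le_iff₀ hq]
  exact (hC ⟨p, hp, rfl⟩).trans (le_max_left _ _)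

theorem pdX_P_eq {p : ℝ × ℝ} (hp : p ∈ F.Ω) :
    pdX F.P p = F.u p * pdY F.v p - F.v p * pdY F.u p := by
  linear_combination F.euler_x p hp - F.u p * F.incompressible p hp

theorem pdY_P_add_eq {p : ℝ × ℝ} (hp : p ∈ F.Ω) :
    pdY F.P p + g = F.v p * pdX F.u p - F.u p * pdX F.v p := by
  linear_combination F.euler_y p hp - F.v p * F.incompressible p hp

theorem pdY_P_bed (x : ℝ) : pdY F.P (x, -d) + g = 0 := by
  have hu := F.u_smooth.continuous
  have hv := F.v_smooth.continuous
  have hvx := continuous_pdX F.v_smooth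
  have hvy := continuous_pdY F.v_smooth
  have hPy := continuous_pdY (F.P_smooth.of_le one_le_two)
  have h := F.eqOn_closure (f₁ := fun p => F.u p * pdX F.v p + F.v p * pdY F.v p)
    (f₂ := fun p => -(pdY F.P p) - g) (by fun_prop) (by fun_prop) F.euler_y _
    (F.bed_mem_closure x)
  have hvx : pdX F.v (x, -d) = 0 := by
    refine pdX_eq_of_hasDerivAt F.differentiable_v ?_
    simp only [F.bed_kinematic]
    exact hasDerivAt_const _ _
  simp only [hvx, F.bed_kinematic] at h
  linarith

theorem pressure_lower_bound (hg : 0 < g) (hL : 0 < L)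
    (hstag : ∀ p ∈ closure F.Ω, F.u p ^ 2 + F.v p ^ 2 ≠ 0) :
    ∀ p ∈ closure F.Ω, Patm + g * F.minη ≤ F.P p + g * p.2 := by
  obtain ⟨k, hk, hkle⟩ := F.exists_neg_two_mul_vort_mul_u_le hL hstag
  intro p hp
  rw [← neg_le_neg_iff]
  refine le_of_forall_pos_add_mul_le (b := Real.exp (k * p.2)) (D := Real.exp (k * F.maxη))
    fun ε hε => ?_
  set f : ℝ × ℝ → ℝ := fun p => -(F.P p + g * p.2) + ε * Real.exp (k * p.2)
  have hf : ContDiff ℝ 2 f :=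
    (F.P_smooth.add (contDiff_const.mul contDiff_snd)).neg.add
      (contDiff_const.mul (Real.contDiff_exp.comp (contDiff_const.mul contDiff_snd)))
  have hfd := hf.differentiable two_ne_zero
  have hX : ∀ p, pdX f p = -pdX F.P p := fun p => by
    refine pdX_eq_of_hasDerivAt hfd ?_
    exact ((hasDerivAt_pdX F.differentiable_P p).add_const (g * p.2)).neg.add_const
      (ε * Real.exp (k * p.2))
  have hexp : ∀ y, HasDerivAt (fun y => Real.exp (k * y)) (k * Real.exp (k * y)) y := fun y => by
    simpa [mul_comm] using ((hasDerivAt_id y).const_mul k).exp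
  have hY : ∀ p, pdY f p = -(pdY F.P p + g) + ε * (k * Real.exp (k * p.2)) := fun p => by
    refine pdY_eq_of_hasDerivAt hfd ?_
    have hg : HasDerivAt (fun y => g * y) g p.2 := by
      simpa using (hasDerivAt_id p.2).const_mul g
    exact ((hasDerivAt_pdY F.differentiable_P p).add hg).neg.add ((hexp p.2).const_mul ε)
  refine F.le_of_surface_le hL hfd (fun p hp => ?_) (fun t => ?_) (fun p hp hpc hmax => ?_)
    (fun x => ?_) p hp
  · simp only [f, F.P_periodic]
  · simp only [f, F.surface_pressure]
    have h1 := F.minη_le_Y t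
    have h2 := F.Y_le_maxη t
    gcongr
  · have hPX := (contDiff_pdX F.P_smooth).differentiable one_ne_zero
    have hPY := (contDiff_pdY F.P_smooth).differentiable one_ne_zero
    have hXX : pdX (pdX f) p = -pdX (pdX F.P) p := by
      refine pdX_eq_of_hasDerivAt ((contDiff_pdX hf).differentiable one_ne_zero) ?_
      simp only [hX]
      exact (hasDerivAt_pdX hPX p).neg
    have hYY : pdY (pdY f) p = -pdY (pdY F.P) p + ε * (k * (k * Real.exp (k * p.2))) := by
      refine pdY_eq_of_hasDerivAt ((contDiff_pdY hf).differentiable one_ne_zero) ?_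
      simp only [hY]
      exact ((hasDerivAt_pdY hPY p).add_const g).neg.add (((hexp p.2).const_mul k).const_mul ε)
    have hPg : pdY (fun p => pdY F.P p + g) p = pdY (pdY F.P) p :=
      pdY_eq_of_hasDerivAt (hPY.add_const g) ((hasDerivAt_pdY hPY p).add_const g)
    have hdet := pdX_add_pdY_eq_two_mul_det F.u_smooth F.v_smooth (hPX p) (hPY.add_const g p)
      (by filter_upwards [F.Ω_open.mem_nhds hp] with q hq using F.pdX_P_eq hq)
      (by filter_upwards [F.Ω_open.mem_nhds hp] with q hq using F.pdY_P_add_eq hq)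
    have h1 := hmax.pdX_eq_zero
    have h2 := hmax.pdY_eq_zero
    have h3 := hmax.pdX_pdX_nonpos hf
    have h4 := hmax.pdY_pdY_nonpos hf
    have h5 := hkle p hpc
    have hinc := F.incompressible p hp
    rw [hX, F.pdX_P_eq hp] at h1
    rw [hY, F.pdY_P_add_eq hp] at h2
    rw [hXX] at h3
    rw [hYY] at h4
    rw [hPg] at hdet
    rw [vort] at h5
    have hq : 0 < F.u p ^ 2 + F.v p ^ 2 := (hstag p hpc.1).symm.lt_of_le (by positivity)
    have hκ : 0 < ε * (k * Real.exp (k * p.2)) := by positivity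
    set κ := ε * (k * Real.exp (k * p.2))
    have h6 : k * κ ≤ 2 * (pdX F.u p * pdY F.v p - pdY F.u p * pdX F.v p) := by
      have : k * κ = ε * (k * (k * Real.exp (k * p.2))) := by simp only [κ]; ring
      linarith
    set a := pdX F.u p
    have hvy : pdY F.v p = -a := by linarith
    rw [hvy] at h1 h6
    have h7 : (F.u p ^ 2 + F.v p ^ 2) * (2 * (a * -a - pdY F.u p * pdX F.v p)) =
        -2 * κ ^ 2 - 2 * (pdX F.v p - pdY F.u p) * F.u p * κ := by
      have hκe : κ = F.v p * a - F.u p * pdX F.v p := by linarith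
      rw [hκe]
      linear_combination -2 * (F.u p * a + F.v p * pdX F.v p) * h1
    have h8 := mul_le_mul_of_nonneg_left h6 hq.le
    rw [h7] at h8
    have h9 := mul_le_mul_of_nonneg_left h5 hκ.le
    nlinarith [pow_pos hκ 2]
  · rw [hY, F.pdY_P_bed]
    positivity

theorem ψ_nonpos_of_u_bed_pos (hL : 0 < L)
    (hstag : ∀ p ∈ closure F.Ω, F.u p ^ 2 + F.v p ^ 2 ≠ 0) (hbed : ∀ x, 0 < F.u (x, -d)) :
    ∀ p ∈ closure F.Ω, F.ψ p ≤ 0 := by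
  refine F.le_of_surface_le hL F.differentiable_ψ F.ψ_periodic (fun s => (F.psi_surface s).le)
    (fun p hp _ hmax => ?_) fun x => ?_
  · have hp' := subset_closure hp
    have h1 := hmax.pdX_eq_zero
    have h2 := hmax.pdY_eq_zero
    rw [F.psi_x p hp', neg_eq_zero] at h1
    rw [F.psi_y p hp'] at h2
    exact hstag p hp' (by rw [h1, h2]; norm_num)
  · rw [F.psi_y _ (F.bed_mem_closure x)]
    exact hbed x

theorem exists_ψ_pos_of_u_trough_neg {s : ℝ} (hs : F.Y s = F.minη)
    (hu : F.u (F.X s, F.Y s) < 0) : ∃ p ∈ F.Ω, 0 < F.ψ p := by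
  have hd := hasDerivAt_pdY F.differentiable_ψ (F.X s, F.Y s)
  rw [F.psi_y _ (F.surf_mem_closure s)] at hd
  obtain ⟨y, hy, hy'⟩ :=
    ((hd.eventually_lt_left hu).and (Ioo_mem_nhdsLT (F.S_above_bed s))).exists
  rw [F.psi_surface] at hy
  exact ⟨(F.X s, y), F.mem_of_lt_Y hy'.1 fun t => (hy'.2.trans_eq hs).trans_le (F.minη_le_Y t), hy⟩

theorem exists_ψ_pos_of_u_crest_neg (hL : 0 < L) {s : ℝ} (hs : F.Y s = F.maxη)
    (hu : F.u (F.X s, F.Y s) < 0) : ∃ p ∈ F.Ω, 0 < F.ψ p := by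
  have hopen : IsOpen {p | pdY F.ψ p < 0} :=
    isOpen_lt (continuous_pdY (F.ψ_smooth.of_le one_le_two)) continuous_const
  obtain ⟨r, hr, hball⟩ := Metric.isOpen_iff.1 hopen (F.X s, F.Y s)
    (by rwa [mem_ofPred_eq, F.psi_y _ (F.surf_mem_closure s)])
  obtain ⟨⟨x, y⟩, hpb, hp⟩ := mem_closure_iff.1 (F.surf_mem_closure s) _ Metric.isOpen_ball
    (Metric.mem_ball_self hr)
  rw [← ball_prod_same, mem_prod, Real.ball_eq_Ioo, Real.ball_eq_Ioo] at hpb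
  have hyle : y ≤ F.maxη := F.le_of_mem hL F.Y_le_maxη hp
  have hneg : ∀ y' ∈ Icc y (F.maxη + r / 2), pdY F.ψ (x, y') < 0 := by
    intro y' hy'
    refine hball ?_
    rw [← ball_prod_same, mem_prod, Real.ball_eq_Ioo, Real.ball_eq_Ioo]
    exact ⟨hpb.1, hpb.2.1.trans_le hy'.1, by rw [hs]; linarith [hy'.2]⟩
  obtain ⟨⟨x', y'⟩, ⟨hx', hy'⟩, hqf⟩ :
      ∃ q ∈ ({x} ×ˢ Icc y (F.maxη + r / 2) : Set (ℝ × ℝ)), q ∈ frontier F.Ω := by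
    by_contra! h
    have hsub := (isPreconnected_singleton.prod isPreconnected_Icc :
      IsPreconnected ({x} ×ˢ Icc y (F.maxη + r / 2))).subset_of_disjoint_frontier_of_isOpen
        F.Ω_open ⟨(x, y), ⟨rfl, le_rfl, by linarith⟩, hp⟩ h
    have htop := F.le_of_mem hL F.Y_le_maxη
      (hsub (mk_mem_prod rfl (right_mem_Icc.2 (by linarith))))
    simp only at htop
    linarith
  obtain rfl : x' = x := hx'
  have hlt : y < y' := hy'.1.lt_of_ne fun h => F.notMem_frontier hp (by rwa [h])
  have hψ : F.ψ (x', y') = 0 := by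
    have h := hqf
    rw [F.Ω_frontier] at h
    rcases h with ⟨t, ht⟩ | h
    · rw [← ht]
      exact F.psi_surface t
    · exact absurd h ((F.neg_d_lt_of_mem hp).trans hlt).ne'
  have hd := fun y => hasDerivAt_pdY F.differentiable_ψ (x', y)
  have hanti := strictAntiOn_of_deriv_neg (convex_Icc y y')
    (fun y _ => (hd y).continuousAt.continuousWithinAt) fun z hz => by
      rw [(hd z).deriv]
      rw [interior_Icc] at hz
      exact hneg z ⟨hz.1.le, hz.2.le.trans hy'.2⟩
  exact ⟨_, hp, hψ.symm.trans_lt (hanti (left_mem_Icc.2 hlt.le) (right_mem_Icc.2 hlt.le) hlt)⟩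

theorem u_bed_neg (hL : 0 < L) (hstag : ∀ p ∈ closure F.Ω, F.u p ^ 2 + F.v p ^ 2 ≠ 0) {s : ℝ}
    (hs : F.Y s = F.maxη ∨ F.Y s = F.minη) (hu : F.u (F.X s, F.Y s) < 0) (x : ℝ) :
    F.u (x, -d) < 0 := by
  obtain ⟨p, hp, hψ⟩ := hs.elim (fun h => F.exists_ψ_pos_of_u_crest_neg hL h hu)
    fun h => F.exists_ψ_pos_of_u_trough_neg h hu
  have hne : ∀ x, F.u (x, -d) ≠ 0 := fun x h =>
    hstag _ (F.bed_mem_closure x) (by rw [h, F.bed_kinematic]; norm_num)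
  have hc : Continuous fun x => F.u (x, -d) := F.u_smooth.continuous.comp (by fun_prop)
  by_contra! h
  refine hψ.not_ge (F.ψ_nonpos_of_u_bed_pos hL hstag (fun x' => ?_) p (subset_closure hp))
  by_contra! h'
  obtain ⟨x₀, hx₀⟩ := mem_range_of_exists_le_of_exists_ge hc ⟨x', h'⟩ ⟨x, h⟩
  exact hne x₀ hx₀

end GenPeriodicFlow

/-- **Speed maximized at troughs for nonnegative vorticity.**  For a nontrivial flow with
no stagnation points in the closure of `Ω`, if `ω ≥ 0` throughout `Ω` and `u < 0` at some
crest or at some trough, then the relative speed `√(u² + v²)` is maximized at every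
trough. -/
theorem speed_maximized_at_troughs (g Patm L d : ℝ) (hg : 0 < g) (hL : 0 < L) (hd : 0 < d)
    (F : GenPeriodicFlow g Patm L d)
    (hnt : F.Nontrivial')
    (hstag : ∀ p ∈ closure F.Ω, F.u p ^ 2 + F.v p ^ 2 ≠ 0)
    (hω : ∀ p ∈ F.Ω, 0 ≤ F.vort p)
    (hu : ∃ s, (F.Y s = F.maxη ∨ F.Y s = F.minη) ∧ F.u (F.X s, F.Y s) < 0) :
    ∀ s', F.Y s' = F.minη → ∀ p ∈ closure F.Ω,
      F.u p ^ 2 + F.v p ^ 2 ≤ F.u (F.X s', F.Y s') ^ 2 + F.v (F.X s', F.Y s') ^ 2 := by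
  obtain ⟨s, hs, hus⟩ := hu
  have hbed := F.u_bed_neg hL hstag hs hus
  intro s' hs' p hp
  have h1 := F.head_le_surface hL hstag hω hbed s' p hp
  have h2 := F.pressure_lower_bound hg hL hstag p hp
  simp only [GenPeriodicFlow.head, F.surface_pressure] at h1
  rw [← hs'] at h2
  linarith
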